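/- Let T : M_n(ℂ) → M_n(ℂ) be an ℝ-linear map such that σ(T(x)) ∩ σ(x) ≠ ∅ for all x ∈ M_n(ℂ), where σ denotes the set of eigenvalues. Then T is ℂ-linear. -/

import Mathlib

open Matrix

noncomputable def SS : Subalgebra ℂ (ℝ → ℂ) :=
  (Polynomial.aeval (R := ℂ) (fun t : ℝ => (t : ℂ))).range

lemma mem_SS (f : ℝ → ℂ) : f ∈ SS ↔ ∃ p : Polynomial ℂ, ∀ t : ℝ, f t = p.eval (t : ℂ) := by
  have key : ∀ (p : Polynomial ℂ) (t : ℝ),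
      Polynomial.aeval (R := ℂ) (fun t : ℝ => (t : ℂ)) p t = p.eval (t : ℂ) := by
    intro p t
    induction p using Polynomial.induction_on' with
    | add p q hp hq => simp [hp, hq]
    | monomial k a => simp [Polynomial.aeval_monomial]
  constructor
  · rintro ⟨p, hp⟩
    refine ⟨p, fun t => ?_⟩
    rw [← hp]
    exact key p t
  · rintro ⟨p, hp⟩
    exact ⟨p, funext fun t => (key p t).trans (hp t).symm⟩

lemma SS_mul_zero {f g : ℝ → ℂ} (hf : f ∈ SS) (hg : g ∈ SS) (h : ∀ t, f t * g t = 0) :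
    (∀ t, f t = 0) ∨ (∀ t, g t = 0) := by
  obtain ⟨p, hp⟩ := (mem_SS f).1 hf
  obtain ⟨q, hq⟩ := (mem_SS g).1 hg
  have hpq : p * q = 0 := by
    apply Polynomial.eq_zero_of_infinite_isRoot
    refine Set.Infinite.mono ?_ (Set.infinite_range_of_injective Complex.ofReal_injective)
    rintro _ ⟨t, rfl⟩
    have := h t
    rw [hp, hq] at this
    simpa [Polynomial.IsRoot] using this
  rcases mul_eq_zero.1 hpq with h0 | h0
  · left; intro t; simp [hp, h0]
  · right; intro t; simp [hq, h0]

lemma SS_conj {f : ℝ → ℂ} (hf : f ∈ SS) : (fun t => (starRingEnd ℂ) (f t)) ∈ SS := by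
  obtain ⟨p, hp⟩ := (mem_SS f).1 hf
  refine (mem_SS _).2 ⟨p.map (starRingEnd ℂ), fun t => ?_⟩
  rw [hp]
  have := Polynomial.eval_map_apply (f := starRingEnd ℂ) (p := p) (t : ℂ)
  rw [Complex.conj_ofReal] at this
  exact this.symm

/-- functions that are polynomial along each real line -/
def LP (E : Type*) [AddCommGroup E] [Module ℝ E] : Subalgebra ℂ (E → ℂ) where
  carrier := {f | ∀ a b : E, (fun t : ℝ => f (a + t • b)) ∈ SS}
  mul_mem' hf hg a b := SS.mul_mem (hf a b) (hg a b)
  add_mem' hf hg a b := SS.add_mem (hf a b) (hg a b)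
  algebraMap_mem' r _ _ := SS.algebraMap_mem r

section
variable {E : Type*} [AddCommGroup E] [Module ℝ E]

lemma LP_mul_zero {f g : E → ℂ} (hf : f ∈ LP E) (hg : g ∈ LP E) (h : ∀ e, f e * g e = 0) :
    (∀ e, f e = 0) ∨ (∀ e, g e = 0) := by
  by_contra hc
  push Not at hc
  obtain ⟨⟨a, ha⟩, ⟨b, hb⟩⟩ := hc
  rcases SS_mul_zero (hf a (b - a)) (hg a (b - a)) (fun t => h _) with h1 | h1
  · exact ha (by simpa using h1 0)
  · exact hb (by simpa using h1 1)

lemma LP_prod_zero {ι : Type*} (s : Finset ι) {f : ι → E → ℂ} (hf : ∀ i, f i ∈ LP E)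
    (h : ∀ e, ∏ i ∈ s, f i e = 0) : ∃ i ∈ s, ∀ e, f i e = 0 := by
  classical
  induction s using Finset.induction_on with
  | empty => simpa using h 0
  | insert a s ha ih =>
    have h' : ∀ e, f a e * (∏ i ∈ s, f i) e = 0 := by
      intro e
      have := h e
      rwa [Finset.prod_insert ha, ← Finset.prod_apply] at this
    rcases LP_mul_zero (hf a) ((LP E).prod_mem fun i _ => hf i) h' with h1 | h1
    · exact ⟨a, by simp, h1⟩
    · obtain ⟨i, hi, h2⟩ := ih (fun e => by rw [← Finset.prod_apply]; exact h1 e)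
      exact ⟨i, by simp [hi], h2⟩

lemma LP_conj {f : E → ℂ} (hf : f ∈ LP E) : (fun t => (starRingEnd ℂ) (f t)) ∈ LP E :=
  fun a b => SS_conj (hf a b)

lemma LP_const (c : ℂ) : (fun _ => c) ∈ LP E := (LP E).algebraMap_mem c

lemma LP_mul {f g : E → ℂ} (hf : f ∈ LP E) (hg : g ∈ LP E) : (fun e => f e * g e) ∈ LP E :=
  (LP E).mul_mem hf hg

lemma LP_add {f g : E → ℂ} (hf : f ∈ LP E) (hg : g ∈ LP E) : (fun e => f e + g e) ∈ LP E :=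
  (LP E).add_mem hf hg

lemma LP_sub {f g : E → ℂ} (hf : f ∈ LP E) (hg : g ∈ LP E) : (fun e => f e - g e) ∈ LP E :=
  (LP E).sub_mem hf hg

lemma LP_sum {ι : Type*} (s : Finset ι) {f : ι → E → ℂ} (hf : ∀ i, f i ∈ LP E) :
    (fun e => ∑ i ∈ s, f i e) ∈ LP E := by
  have := (LP E).sum_mem (t := s) (f := f) fun i _ => hf i
  convert this using 1
  ext e; simp

lemma LP_prod {ι : Type*} (s : Finset ι) {f : ι → E → ℂ} (hf : ∀ i, f i ∈ LP E) :
    (fun e => ∏ i ∈ s, f i e) ∈ LP E := by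
  have := (LP E).prod_mem (t := s) (f := f) fun i _ => hf i
  convert this using 1
  ext e; simp

lemma LP_linear (f : E →ₗ[ℝ] ℂ) : (fun e => f e) ∈ LP E := by
  intro a b
  refine (mem_SS _).2 ⟨Polynomial.C (f a) + Polynomial.X * Polynomial.C (f b), fun t => ?_⟩
  simp
  ring

lemma LP_re {f : E → ℂ} (hf : f ∈ LP E) : (fun t => ((f t).re : ℂ)) ∈ LP E := by
  have := LP_mul (LP_add hf (LP_conj hf)) (LP_const (1/2 : ℂ))
  convert this using 2 with e
  rw [Complex.add_conj]; push_cast; ring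

lemma LP_im {f : E → ℂ} (hf : f ∈ LP E) : (fun t => ((f t).im : ℂ)) ∈ LP E := by
  have := LP_re (LP_mul hf (LP_const (-Complex.I)))
  convert this using 2 with e
  simp

variable {n : ℕ}
/-- matrix-valued version -/
def LPM (M : E → Matrix (Fin n) (Fin n) ℂ) : Prop := ∀ i j, (fun e => M e i j) ∈ LP E

lemma LPM.mul {M N : E → Matrix (Fin n) (Fin n) ℂ} (hM : LPM M) (hN : LPM N) :
    LPM (fun e => M e * N e) := by
  intro i j
  simp only [Matrix.mul_apply]
  exact LP_sum _ fun k => LP_mul (hM i k) (hN k j)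

lemma LPM.sub {M N : E → Matrix (Fin n) (Fin n) ℂ} (hM : LPM M) (hN : LPM N) :
    LPM (fun e => M e - N e) := fun i j => LP_sub (hM i j) (hN i j)

lemma LPM.det {M : E → Matrix (Fin n) (Fin n) ℂ} (hM : LPM M) :
    (fun e => (M e).det) ∈ LP E := by
  simp only [Matrix.det_apply']
  exact LP_sum _ fun σ => LP_mul (LP_const _) (LP_prod _ fun i => hM _ _)

lemma LPM.trace {M : E → Matrix (Fin n) (Fin n) ℂ} (hM : LPM M) :
    (fun e => (M e).trace) ∈ LP E := by
  simp only [Matrix.trace, Matrix.diag_apply]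
  exact LP_sum _ fun i => hM _ _

lemma LPM.const (M : Matrix (Fin n) (Fin n) ℂ) : LPM (fun _ : E => M) := fun _ _ => LP_const _

lemma LPM.diagonal {d : E → Fin n → ℂ} (hd : ∀ i, (fun e => d e i) ∈ LP E) :
    LPM (fun e => Matrix.diagonal (d e)) := by
  intro i j
  by_cases h : i = j
  · subst h; simpa using hd i
  · simpa [Matrix.diagonal_apply_ne _ h] using LP_const 0

lemma LPM.smul_one {f : E → ℂ} (hf : f ∈ LP E) :
    LPM (fun e => f e • (1 : Matrix (Fin n) (Fin n) ℂ)) :=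
  fun i j => LP_mul hf (LP_const _)

lemma LPM.adjugate {M : E → Matrix (Fin n) (Fin n) ℂ} (hM : LPM M) :
    LPM (fun e => (M e).adjugate) := by
  intro i j
  simp only [Matrix.adjugate_apply]
  apply LPM.det
  intro k l
  by_cases h : k = j
  · subst h; simpa using LP_const _
  · simpa [Matrix.updateRow_ne h] using hM k l

lemma LPM.map {M : E → Matrix (Fin n) (Fin n) ℂ} (hM : LPM M)
    (T : Matrix (Fin n) (Fin n) ℂ →ₗ[ℝ] Matrix (Fin n) (Fin n) ℂ) : LPM (fun e => T (M e)) := by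
  intro i j
  have key : ∀ X : Matrix (Fin n) (Fin n) ℂ, T X i j =
      ∑ k, ∑ l, (((X k l).re : ℂ) * T (Matrix.single k l 1) i j
        + ((X k l).im : ℂ) * T (Matrix.single k l Complex.I) i j) := by
    intro X
    conv_lhs => rw [Matrix.matrix_eq_sum_single X]
    simp only [map_sum, Matrix.sum_apply]
    refine Finset.sum_congr rfl fun k _ => Finset.sum_congr rfl fun l _ => ?_
    have : Matrix.single k l (X k l) = (X k l).re • Matrix.single k l (1 : ℂ)
        + (X k l).im • Matrix.single k l Complex.I := by
      rw [Matrix.smul_single, Matrix.smul_single, ← Matrix.single_add]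
      congr 1
      apply Complex.ext <;> simp
    rw [this, map_add, map_smul, map_smul]
    simp
  rw [show (fun e => T (M e) i j) = _ from funext fun e => key (M e)]
  exact LP_sum _ fun k => LP_sum _ fun l =>
    LP_add (LP_mul (LP_re (hM k l)) (LP_const _)) (LP_mul (LP_im (hM k l)) (LP_const _))
end

section
variable {n : ℕ}

lemma det_zero_of_mem {A : Matrix (Fin n) (Fin n) ℂ} {μ : ℂ} (h : μ ∈ spectrum ℂ A) :
    (A - μ • (1 : Matrix (Fin n) (Fin n) ℂ)).det = 0 := by
  rw [spectrum.mem_iff, Algebra.algebraMap_eq_smul_one, ← IsUnit.neg_iff, neg_sub,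
    Matrix.isUnit_iff_isUnit_det, isUnit_iff_ne_zero, not_not] at h
  exact h

lemma step1 (T : Matrix (Fin n) (Fin n) ℂ →ₗ[ℝ] Matrix (Fin n) (Fin n) ℂ)
    (hspec : ∀ x : Matrix (Fin n) (Fin n) ℂ, (spectrum ℂ (T x) ∩ spectrum ℂ x).Nonempty) :
    ∃ i : Fin n, ∀ (P : Matrix (Fin n) (Fin n) ℂ) (d : Fin n → ℂ),
      (T (P * Matrix.diagonal d * P.adjugate) -
        (P.det * d i) • (1 : Matrix (Fin n) (Fin n) ℂ)).det = 0 := by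
  let E := Matrix (Fin n) (Fin n) ℂ × (Fin n → ℂ)
  have hP : LPM (fun e : E => e.1) := by
    intro i j
    exact LP_linear ((LinearMap.proj (R := ℝ) j).comp
      ((LinearMap.proj (R := ℝ) (φ := fun _ : Fin n => Fin n → ℂ) i).comp
        (LinearMap.fst ℝ (Fin n → Fin n → ℂ) (Fin n → ℂ))))
  have hd : ∀ i, (fun e : E => e.2 i) ∈ LP E := by
    intro i
    exact LP_linear ((LinearMap.proj (R := ℝ) i).comp
        (LinearMap.snd ℝ (Matrix (Fin n) (Fin n) ℂ) (Fin n → ℂ)))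
  let F : Fin n → E → ℂ := fun i e => (T (e.1 * Matrix.diagonal e.2 * e.1.adjugate) -
        (e.1.det * e.2 i) • (1 : Matrix (Fin n) (Fin n) ℂ)).det
  have hF : ∀ i, F i ∈ LP E := fun i =>
    (((hP.mul (LPM.diagonal hd)).mul hP.adjugate).map T |>.sub
      (LPM.smul_one (LP_mul hP.det (hd i)))).det
  have hz : ∀ e : E, e.1.det * ∏ i, F i e = 0 := by
    rintro ⟨P, d⟩
    by_cases h0 : P.det = 0
    · simp [h0]
    apply mul_eq_zero_of_right
    obtain ⟨μ, h1, h2⟩ := hspec (P * Matrix.diagonal d * P.adjugate)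
    have h1 := det_zero_of_mem h1
    have h2 := det_zero_of_mem h2
    have h3 : (P * Matrix.diagonal d * P.adjugate - μ • (1 : Matrix (Fin n) (Fin n) ℂ)) * P
        = P * Matrix.diagonal (fun i => P.det * d i - μ) := by
      have : Matrix.diagonal (fun i => P.det * d i - μ) =
          P.det • Matrix.diagonal d - μ • (1 : Matrix (Fin n) (Fin n) ℂ) := by
        ext i j
        by_cases h : i = j
        · subst h; simp
        · simp [h]
      rw [this, sub_mul, mul_assoc, Matrix.adjugate_mul]
      simp [mul_sub]
    have h4 := congrArg Matrix.det h3
    rw [Matrix.det_mul, Matrix.det_mul, h2, zero_mul, Matrix.det_diagonal] at h4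
    have h5 := (mul_eq_zero.1 h4.symm).resolve_left h0
    obtain ⟨i, hi, h6⟩ := Finset.prod_eq_zero_iff.1 h5
    refine Finset.prod_eq_zero hi ?_
    simp only [F]
    rw [sub_eq_zero.1 h6]
    exact h1
  rcases LP_mul_zero hP.det (LP_prod _ hF) hz with h | h
  · exact absurd (h (1, 0)) (by simp)
  · obtain ⟨i, _, hi⟩ := LP_prod_zero _ hF h
    exact ⟨i, fun P d => hi (P, d)⟩

lemma step2 (T : Matrix (Fin n) (Fin n) ℂ →ₗ[ℝ] Matrix (Fin n) (Fin n) ℂ)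
    (hspec : ∀ x : Matrix (Fin n) (Fin n) ℂ, (spectrum ℂ (T x) ∩ spectrum ℂ x).Nonempty)
    (P Q : Matrix (Fin n) (Fin n) ℂ) (hPQ : P * Q = 1) (d : Fin n → ℂ) (j : Fin n) :
    (T (P * Matrix.diagonal d * Q) - d j • (1 : Matrix (Fin n) (Fin n) ℂ)).det = 0 := by
  obtain ⟨i, hi⟩ := step1 T hspec
  have key : ∀ (P Q : Matrix (Fin n) (Fin n) ℂ) (hPQ : P * Q = 1) (d : Fin n → ℂ),
      (T (P * Matrix.diagonal d * Q) - d i • (1 : Matrix (Fin n) (Fin n) ℂ)).det = 0 := by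
    intro P Q hPQ d
    have h0 : P.det ≠ 0 := by
      intro h
      have := congrArg Matrix.det hPQ
      simp [h] at this
    have hadj : P.adjugate = P.det • Q := by
      calc P.adjugate = P.adjugate * (P * Q) := by rw [hPQ, mul_one]
        _ = P.det • Q := by rw [← mul_assoc, Matrix.adjugate_mul]; simp
    have h1 := hi P (P.det⁻¹ • d)
    rw [hadj, Matrix.diagonal_smul, Matrix.mul_smul, Matrix.mul_smul, Matrix.smul_mul, smul_smul,
      mul_inv_cancel₀ h0, one_smul] at h1
    simpa [h0] using h1
  let σ := Equiv.swap i j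
  have h := key (P.submatrix id σ) (Q.submatrix σ id) (by
    rw [Matrix.submatrix_mul_equiv, hPQ]; simp) (d ∘ σ)
  rw [← Matrix.submatrix_diagonal_equiv, Matrix.submatrix_mul_equiv, Matrix.submatrix_mul_equiv] at h
  simpa [σ] using h

lemma trace_sq_of_eig (A : Matrix (Fin n) (Fin n) ℂ) (d : Fin n → ℂ) (hd : Function.Injective d)
    (h : ∀ j, (A - d j • (1 : Matrix (Fin n) (Fin n) ℂ)).det = 0) :
    (A * A).trace = ∑ j, d j * d j := by
  have h1 : ∀ j, ∃ v : Fin n → ℂ, v ≠ 0 ∧ A *ᵥ v = d j • v := by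
    intro j
    obtain ⟨v, hv, h2⟩ := Matrix.exists_mulVec_eq_zero_iff.2 (h j)
    refine ⟨v, hv, ?_⟩
    rw [Matrix.sub_mulVec, sub_eq_zero] at h2
    rw [h2, Matrix.smul_mulVec, Matrix.one_mulVec]
  choose v hv hA using h1
  have hli : LinearIndependent ℂ v := by
    apply Module.End.eigenvectors_linearIndependent' (Matrix.toLin' A) d hd
    intro i
    refine ⟨Module.End.mem_eigenspace_iff.2 ?_, hv i⟩
    simpa using hA i
  let P : Matrix (Fin n) (Fin n) ℂ := (Matrix.of v)ᵀ
  have hu : IsUnit P := Matrix.linearIndependent_cols_iff_isUnit.1 hli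
  have hAP : A * P = P * Matrix.diagonal d := by
    ext i j
    have := congrFun (hA j) i
    rw [Matrix.mul_diagonal]
    simp only [Matrix.mulVec, dotProduct, Pi.smul_apply, smul_eq_mul] at this
    simp only [Matrix.mul_apply, P, Matrix.transpose_apply, Matrix.of_apply]
    rw [this, mul_comm]
  obtain ⟨Q, hPQ, hQP⟩ := isUnit_iff_exists.1 hu
  have hA2 : A = P * Matrix.diagonal d * Q := by
    rw [← hAP, mul_assoc, hPQ, mul_one]
  have : A * A = P * (Matrix.diagonal d * Matrix.diagonal d * Q) := by
    nth_rewrite 1 [hA2]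
    rw [hA2]
    calc P * diagonal d * Q * (P * diagonal d * Q) = P * diagonal d * (Q * P) * diagonal d * Q := by
          noncomm_ring
      _ = _ := by rw [hQP]; noncomm_ring
  rw [this, Matrix.trace_mul_comm, mul_assoc, hQP, mul_one, Matrix.diagonal_mul_diagonal,
    Matrix.trace_diagonal]

lemma trace_conj (P Q : Matrix (Fin n) (Fin n) ℂ) (hPQ : P * Q = 1) (d : Fin n → ℂ) :
    (P * Matrix.diagonal d * Q * (P * Matrix.diagonal d * Q)).trace = ∑ j, d j * d j := by
  have hQP : Q * P = 1 := mul_eq_one_comm.1 hPQ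
  have : P * Matrix.diagonal d * Q * (P * Matrix.diagonal d * Q) =
      P * (Matrix.diagonal d * Matrix.diagonal d * Q) := by
    calc P * diagonal d * Q * (P * diagonal d * Q) = P * diagonal d * (Q * P) * diagonal d * Q := by
          noncomm_ring
      _ = _ := by rw [hQP]; noncomm_ring
  rw [this, Matrix.trace_mul_comm, mul_assoc, hQP, mul_one, Matrix.diagonal_mul_diagonal,
    Matrix.trace_diagonal]

lemma step4 (T : Matrix (Fin n) (Fin n) ℂ →ₗ[ℝ] Matrix (Fin n) (Fin n) ℂ)
    (hspec : ∀ x : Matrix (Fin n) (Fin n) ℂ, (spectrum ℂ (T x) ∩ spectrum ℂ x).Nonempty)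
    (P Q : Matrix (Fin n) (Fin n) ℂ) (hPQ : P * Q = 1) (d : Fin n → ℂ) :
    (T (P * Matrix.diagonal d * Q) * T (P * Matrix.diagonal d * Q)).trace = ∑ j, d j * d j := by
  have hd : ∀ i, (fun e : Fin n → ℂ => e i) ∈ LP (Fin n → ℂ) := fun i =>
    LP_linear (LinearMap.proj (R := ℝ) (φ := fun _ : Fin n => ℂ) i)
  have hT : LPM (fun e : Fin n → ℂ => T (P * Matrix.diagonal e * Q)) :=
    (((LPM.const P).mul (LPM.diagonal hd)).mul (LPM.const Q)).map T
  have h1 := LP_sub (hT.mul hT).trace (LP_sum Finset.univ fun i => LP_mul (hd i) (hd i))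
  have h2 := LP_prod (Finset.univ : Finset (Fin n)).offDiag
    (fun p : Fin n × Fin n => LP_sub (hd p.1) (hd p.2))
  rcases LP_mul_zero h1 h2 (by
    intro e
    by_cases he : Function.Injective e
    · rw [trace_sq_of_eig _ e he (step2 T hspec P Q hPQ e), sub_self, zero_mul]
    · apply mul_eq_zero_of_right
      simp only [Function.Injective, not_forall] at he
      obtain ⟨i, j, hij, hne⟩ := he
      exact Finset.prod_eq_zero (i := (i, j)) (by simp [hne]) (by simp [hij])) with h | h
  · exact sub_eq_zero.1 (h d)
  · exfalso
    have h3 := h (fun i => ((i : ℕ) : ℂ))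
    obtain ⟨⟨i, j⟩, hi, h6⟩ := Finset.prod_eq_zero_iff.1 h3
    simp only [Finset.mem_offDiag] at hi
    apply hi.2.2
    have := sub_eq_zero.1 h6
    exact Fin.ext (by exact_mod_cast this)

lemma transv (d : Fin n → ℂ) (i j : Fin n) (hij : i ≠ j) (c : ℂ) :
    (1 + Matrix.single i j c) * Matrix.diagonal d * (1 - Matrix.single i j c) =
      Matrix.diagonal d + Matrix.single i j (c * (d j - d i)) := by
  have h1 : Matrix.single i j c * Matrix.diagonal d = Matrix.single i j (c * d j) := by
    ext k l
    rw [Matrix.mul_diagonal]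
    by_cases h : i = k ∧ j = l
    · obtain ⟨rfl, rfl⟩ := h; simp
    · simp [Matrix.single_apply, h]
  have h2 : Matrix.diagonal d * Matrix.single i j c = Matrix.single i j (d i * c) := by
    ext k l
    rw [Matrix.diagonal_mul]
    by_cases h : i = k ∧ j = l
    · obtain ⟨rfl, rfl⟩ := h; simp
    · simp [Matrix.single_apply, h]
  have h3 : Matrix.single i j (c * d j) * Matrix.single i j c = 0 := by
    simp [Matrix.single_mul_single_of_ne, hij.symm]
  rw [add_mul, one_mul, h1, mul_sub, mul_one, add_mul, h2, h3, mul_sub, add_zero,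
    mul_comm c (d i), sub_eq_add_neg (c * d j), Matrix.single_add, ← Matrix.single_neg]
  abel

lemma transv_inv (i j : Fin n) (hij : i ≠ j) (c : ℂ) :
    (1 + Matrix.single i j c) * (1 - Matrix.single i j c) = 1 := by
  have h3 : Matrix.single i j c * Matrix.single i j c = 0 := by
    simp [Matrix.single_mul_single_of_ne, hij.symm]
  rw [add_mul, mul_sub, mul_sub, h3]; simp

lemma bilin_zero (B : Matrix (Fin n) (Fin n) ℂ →ₗ[ℝ] Matrix (Fin n) (Fin n) ℂ →ₗ[ℝ] ℂ)
    (hsymm : ∀ x y, B x y = B y x)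
    (hq : ∀ (P Q : Matrix (Fin n) (Fin n) ℂ), P * Q = 1 → ∀ d : Fin n → ℂ,
      B (P * Matrix.diagonal d * Q) (P * Matrix.diagonal d * Q) = 0) (X Y) : B X Y = 0 := by
  have A0 : ∀ (P Q : Matrix (Fin n) (Fin n) ℂ), P * Q = 1 → ∀ d d' : Fin n → ℂ,
      B (P * Matrix.diagonal d * Q) (P * Matrix.diagonal d' * Q) = 0 := by
    intro P Q hPQ d d'
    have h := hq P Q hPQ (fun k => d k + d' k)
    rw [← Matrix.diagonal_add, mul_add, add_mul] at h
    simp only [map_add, LinearMap.add_apply, hq P Q hPQ] at h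
    rw [hsymm (P * diagonal d' * Q)] at h
    linear_combination h / 2
  have A1 : ∀ (P Q : Matrix (Fin n) (Fin n) ℂ), P * Q = 1 → ∀ (d : Fin n → ℂ) (i j : Fin n)
      (a : ℂ), i ≠ j → d i ≠ d j → 2 * B (P * Matrix.diagonal d * Q) (P * Matrix.single i j a * Q)
        + B (P * Matrix.single i j a * Q) (P * Matrix.single i j a * Q) = 0 := by
    intro P Q hPQ d i j a hij hdij
    let c := a / (d j - d i)
    have hc : c * (d j - d i) = a := div_mul_cancel₀ _ (sub_ne_zero.2 hdij.symm)
    have h := hq (P * (1 + Matrix.single i j c)) ((1 - Matrix.single i j c) * Q) (by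
      calc _ = P * ((1 + Matrix.single i j c) * (1 - Matrix.single i j c)) * Q := by noncomm_ring
        _ = 1 := by rw [transv_inv i j hij, mul_one, hPQ]) d
    have e : P * (1 + Matrix.single i j c) * diagonal d * ((1 - Matrix.single i j c) * Q)
        = P * diagonal d * Q + P * Matrix.single i j a * Q := by
      calc _ = P * ((1 + Matrix.single i j c) * diagonal d * (1 - Matrix.single i j c)) * Q := by
            simp only [mul_assoc]
        _ = _ := by rw [transv d i j hij, hc, mul_add, add_mul]
    rw [e] at h
    simp only [map_add, LinearMap.add_apply, hq P Q hPQ] at h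
    rw [hsymm (P * Matrix.single i j a * Q) (P * diagonal d * Q)] at h
    linear_combination h
  have A2 : ∀ (P Q : Matrix (Fin n) (Fin n) ℂ), P * Q = 1 → ∀ (d : Fin n → ℂ) (i j : Fin n)
      (a : ℂ), i ≠ j → d i ≠ d j →
      B (P * Matrix.diagonal d * Q) (P * Matrix.single i j a * Q) = 0 := by
    intro P Q hPQ d i j a hij hdij
    have h1 := A1 P Q hPQ d i j a hij hdij
    have h2 := A1 P Q hPQ d i j (-a) hij hdij
    have e : P * Matrix.single i j (-a) * Q = - (P * Matrix.single i j a * Q) := by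
      rw [← Matrix.single_neg]; simp
    rw [e] at h2
    simp only [map_neg, LinearMap.neg_apply, neg_neg] at h2
    linear_combination (h1 - h2) / 4
  have A3 : ∀ (P Q : Matrix (Fin n) (Fin n) ℂ), P * Q = 1 → ∀ (d : Fin n → ℂ) (i j : Fin n)
      (a : ℂ), i ≠ j → B (P * Matrix.diagonal d * Q) (P * Matrix.single i j a * Q) = 0 := by
    intro P Q hPQ d i j a hij
    by_cases hd : d i = d j
    · have h1 := A2 P Q hPQ (fun k => d k + (Pi.single i 1 : Fin n → ℂ) k) i j a hij (by simp [hij.symm, hd])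
      have h2 := A2 P Q hPQ (Pi.single i 1) i j a hij (by simp [hij.symm])
      rw [← Matrix.diagonal_add, mul_add, add_mul, map_add, LinearMap.add_apply, h2, add_zero] at h1
      exact h1
    · exact A2 P Q hPQ d i j a hij hd
  have A4 : ∀ (P Q : Matrix (Fin n) (Fin n) ℂ), P * Q = 1 → ∀ (d : Fin n → ℂ) Y,
      B (P * Matrix.diagonal d * Q) Y = 0 := by
    intro P Q hPQ d Y
    have e : Y = P * (Q * Y * P) * Q := by
      calc Y = (P * Q) * Y * (P * Q) := by rw [hPQ]; simp
        _ = _ := by noncomm_ring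
    rw [e, Matrix.matrix_eq_sum_single (Q * Y * P)]
    simp only [Finset.mul_sum, Finset.sum_mul, map_sum]
    refine Finset.sum_eq_zero fun i _ => Finset.sum_eq_zero fun j _ => ?_
    by_cases hij : i = j
    · subst hij
      rw [← Matrix.diagonal_single]
      exact A0 P Q hPQ _ _
    · exact A3 P Q hPQ d i j _ hij
  rw [Matrix.matrix_eq_sum_single X]
  simp only [map_sum, LinearMap.sum_apply]
  refine Finset.sum_eq_zero fun i _ => Finset.sum_eq_zero fun j _ => ?_
  by_cases hij : i = j
  · subst hij
    rw [← Matrix.diagonal_single]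
    simpa using A4 1 1 (by simp) (Pi.single i (X i i)) Y
  · have h1 := A4 _ _ (transv_inv i j hij (X i j)) (Pi.single j 1) Y
    have h2 := A4 1 1 (by simp) (Pi.single j 1) Y
    rw [transv _ i j hij, map_add, LinearMap.add_apply] at h1
    simp only [one_mul, mul_one] at h2
    rw [h2, zero_add] at h1
    simpa [hij] using h1
end

theorem stmt_4 (n : ℕ) (T : Matrix (Fin n) (Fin n) ℂ → Matrix (Fin n) (Fin n) ℂ)
    (hT : IsLinearMap ℝ T)
    (hspec : ∀ x : Matrix (Fin n) (Fin n) ℂ,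
      (spectrum ℂ (T x) ∩ spectrum ℂ x).Nonempty) :
    ∀ (c : ℂ) (x : Matrix (Fin n) (Fin n) ℂ), T (c • x) = c • T x := by
  let L : Matrix (Fin n) (Fin n) ℂ →ₗ[ℝ] Matrix (Fin n) (Fin n) ℂ := hT.mk' T
  have hL : ∀ x, L x = T x := fun x => rfl
  let B : Matrix (Fin n) (Fin n) ℂ →ₗ[ℝ] Matrix (Fin n) (Fin n) ℂ →ₗ[ℝ] ℂ :=
    LinearMap.mk₂ ℝ (fun x y => (L x * L y).trace - (x * y).trace)
      (by intro a b c; simp only [map_add, add_mul, Matrix.trace_add]; ring)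
      (by intro a b c; simp only [map_smul, Matrix.smul_mul, Matrix.trace_smul, smul_sub])
      (by intro a b c; simp only [map_add, mul_add, Matrix.trace_add]; ring)
      (by intro a b c; simp only [map_smul, Matrix.mul_smul, Matrix.trace_smul, smul_sub])
  have hB : ∀ x y, B x y = (L x * L y).trace - (x * y).trace := fun _ _ => rfl
  have key : ∀ x y, (T x * T y).trace = (x * y).trace := by
    intro x y
    have := bilin_zero B
      (fun x y => by rw [hB, hB, Matrix.trace_mul_comm, Matrix.trace_mul_comm x])
      (fun P Q hPQ d => by rw [hB, step4 L hspec P Q hPQ, trace_conj P Q hPQ, sub_self]) x y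
    rw [hB] at this
    exact sub_eq_zero.1 this
  have hinj : Function.Injective L := by
    rw [injective_iff_map_eq_zero]
    intro x hx
    apply Matrix.ext_iff_trace_mul_right.2
    intro y
    rw [← key, ← hL, hx]; simp
  have hsurj : Function.Surjective L := LinearMap.injective_iff_surjective.1 hinj
  intro c x
  apply Matrix.ext_iff_trace_mul_right.2
  intro z
  obtain ⟨y, rfl⟩ := hsurj z
  rw [hL, key, Matrix.smul_mul, Matrix.smul_mul, Matrix.trace_smul, Matrix.trace_smul, key]
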